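/- (Badiale–Tarantello conjecture) Let 2 ≤ N ≤ n be integers and 1 < p < N. Then p/(N−p) is the best constant in the inequality ‖f/|x'|‖_{L^p(ℝⁿ)} ≤ C ‖∇f‖_{L^p(ℝⁿ)}: the inequality holds with C = p/(N−p) for all f ∈ C_0^∞(ℝⁿ \ {x' = 0}), and for every constant C < p/(N−p) there exists f ∈ C_0^∞(ℝⁿ \ {x' = 0}), not identically zero, such that (∫_{ℝⁿ} |f(x)|^p / |x'|^p dx)^{1/p} > C (∫_{ℝⁿ} |∇f(x)|^p dx)^{1/p}. -/

import Mathlib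

open MeasureTheory

/-- The Euclidean norm of `x' = (x_1, …, x_N)`, the first `N` coordinates of `x ∈ ℝⁿ`. -/
noncomputable def sliceNorm {n : ℕ} (N : ℕ) (h : N ≤ n) (x : EuclideanSpace ℝ (Fin n)) : ℝ :=
  Real.sqrt (∑ i : Fin N, (x (Fin.castLE h i)) ^ 2)

/-- The projection `x ↦ x'` onto the first `N` coordinates. -/
noncomputable def sliceProj {n : ℕ} (N : ℕ) (h : N ≤ n) :
    EuclideanSpace ℝ (Fin n) →L[ℝ] EuclideanSpace ℝ (Fin N) :=
  LinearMap.toContinuousLinearMap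
    { toFun := fun x => WithLp.toLp 2 fun i => x (Fin.castLE h i)
      map_add' := fun x y => by ext i; simp
      map_smul' := fun c x => by ext i; simp }

@[simp]
lemma sliceProj_apply {n N : ℕ} (h : N ≤ n) (x : EuclideanSpace ℝ (Fin n)) (i : Fin N) :
    sliceProj N h x i = x (Fin.castLE h i) := rfl

lemma sliceNorm_eq_norm {n N : ℕ} (h : N ≤ n) (x : EuclideanSpace ℝ (Fin n)) :
    sliceNorm N h x = ‖sliceProj N h x‖ := by
  simp [sliceNorm, EuclideanSpace.norm_eq]

lemma sliceProj_ne_zero_iff {n N : ℕ} (h : N ≤ n) (x : EuclideanSpace ℝ (Fin n)) :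
    sliceProj N h x ≠ 0 ↔ ∃ i : Fin N, x (Fin.castLE h i) ≠ 0 := by
  rw [Ne, PiLp.ext_iff, not_forall]
  simp

lemma norm_sliceProj_le {n N : ℕ} (h : N ≤ n) (x : EuclideanSpace ℝ (Fin n)) :
    ‖sliceProj N h x‖ ≤ ‖x‖ := by
  rw [EuclideanSpace.norm_eq, EuclideanSpace.norm_eq]
  apply Real.sqrt_le_sqrt
  have := Finset.sum_le_univ_sum_of_nonneg (s := Finset.univ.map (Fin.castLEEmb h))
    (f := fun i => ‖x i‖ ^ 2) (fun i => by positivity)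
  simpa using this

/-- The embedding `x' ↦ (x', 0)` of the first `N` coordinates. -/
noncomputable def sliceEmb {n : ℕ} (N : ℕ) (h : N ≤ n) (x : EuclideanSpace ℝ (Fin n)) :
    EuclideanSpace ℝ (Fin n) :=
  ∑ i : Fin N, x (Fin.castLE h i) • EuclideanSpace.single (Fin.castLE h i) (1 : ℝ)

lemma sliceProj_sliceEmb {n N : ℕ} (h : N ≤ n) (x : EuclideanSpace ℝ (Fin n)) :
    sliceProj N h (sliceEmb N h x) = sliceProj N h x := by
  ext i
  simp [sliceEmb]

lemma norm_sliceEmb {n N : ℕ} (h : N ≤ n) (x : EuclideanSpace ℝ (Fin n)) :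
    ‖sliceEmb N h x‖ = ‖sliceProj N h x‖ := by
  have h1 : Orthonormal ℝ fun i : Fin N =>
      EuclideanSpace.single (Fin.castLE h i) (1 : ℝ) :=
    (EuclideanSpace.orthonormal_single (𝕜 := ℝ) (ι := Fin n)).comp _ (Fin.castLE_injective h)
  have h2 : ‖sliceEmb N h x‖ ^ 2 = ‖sliceProj N h x‖ ^ 2 := by
    rw [← real_inner_self_eq_norm_sq, sliceEmb, h1.inner_sum, EuclideanSpace.norm_sq_eq]
    simp [sq]
  exact (sq_eq_sq₀ (norm_nonneg _) (norm_nonneg _)).1 h2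

lemma integral_fderiv_sliceEmb {n N : ℕ} (h : N ≤ n) {u : EuclideanSpace ℝ (Fin n) → ℝ}
    (hu : ContDiff ℝ 1 u) (hc : HasCompactSupport u) :
    Integrable (fun x => fderiv ℝ u x (sliceEmb N h x)) ∧
      ∫ x, fderiv ℝ u x (sliceEmb N h x) = -(N * ∫ x, u x) := by
  have hdu : Continuous (fderiv ℝ u) := hu.continuous_fderiv one_ne_zero
  have hui : Integrable u := hu.continuous.integrable_of_hasCompactSupport hc
  have key : ∀ i : Fin n, Integrable (fun x => x i * fderiv ℝ u x (EuclideanSpace.single i 1)) ∧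
      ∫ x, x i * fderiv ℝ u x (EuclideanSpace.single i 1) = -∫ x, u x := by
    intro i
    have hd : ∀ x : EuclideanSpace ℝ (Fin n), fderiv ℝ (fun y : EuclideanSpace ℝ (Fin n) => y i) x
        (EuclideanSpace.single i 1) = 1 := by
      intro x
      have : HasFDerivAt (fun y : EuclideanSpace ℝ (Fin n) => y i)
        (EuclideanSpace.proj i : EuclideanSpace ℝ (Fin n) →L[ℝ] ℝ) x :=
        (EuclideanSpace.proj i : EuclideanSpace ℝ (Fin n) →L[ℝ] ℝ).hasFDerivAt
      rw [this.fderiv]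
      simp
    have hi : Integrable (fun x => x i * fderiv ℝ u x (EuclideanSpace.single i 1)) := by
      apply Continuous.integrable_of_hasCompactSupport (by fun_prop)
      exact HasCompactSupport.mul_left (hc.fderiv_apply ℝ (EuclideanSpace.single i 1))
    refine ⟨hi, ?_⟩
    rw [integral_mul_fderiv_eq_neg_fderiv_mul_of_integrable _ hi]
    · simp [hd]
    · exact Continuous.integrable_of_hasCompactSupport (by fun_prop) hc.mul_left
    · intro x _; fun_prop
    · intro x _; exact hu.differentiable one_ne_zero x
    · simpa [hd] using hui
  have he : (fun x => fderiv ℝ u x (sliceEmb N h x)) = fun x => ∑ i : Fin N,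
      x (Fin.castLE h i) * fderiv ℝ u x (EuclideanSpace.single (Fin.castLE h i) 1) := by
    ext x
    simp [sliceEmb]
  rw [he]
  refine ⟨integrable_finsetSum _ fun i _ => (key _).1, ?_⟩
  rw [integral_finsetSum _ fun (i : Fin N) _ => (key (Fin.castLE h i)).1]
  simp [key]

lemma contDiff_of_forall_mem_tsupport {E F : Type*} [NormedAddCommGroup E] [NormedSpace ℝ E]
    [NormedAddCommGroup F] [NormedSpace ℝ F] {k : WithTop ℕ∞} {f : E → F}
    (h : ∀ x ∈ tsupport f, ContDiffAt ℝ k f x) : ContDiff ℝ k f :=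
  contMDiff_iff_contDiff.1 (contMDiff_of_tsupport fun x hx => contMDiffAt_iff_contDiffAt.2 (h x hx))

lemma contDiff_inv_norm_sliceProj_smul {n N : ℕ} (h : N ≤ n)
    {f : EuclideanSpace ℝ (Fin n) → ℂ} (hf : ContDiff ℝ (⊤ : ℕ∞) f)
    (hs : tsupport f ⊆ {x | sliceProj N h x ≠ 0}) :
    ContDiff ℝ (⊤ : ℕ∞) fun x => ‖sliceProj N h x‖⁻¹ • f x := by
  refine contDiff_of_forall_mem_tsupport fun x hx => ?_
  have hx0 : sliceProj N h x ≠ 0 :=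
    hs (tsupport_smul_subset_right (fun y => ‖sliceProj N h y‖⁻¹) f hx)
  have h1 : ContDiffAt ℝ (⊤ : ℕ∞) (fun y => ‖sliceProj N h y‖) x :=
    (sliceProj N h).contDiff.contDiffAt.norm ℝ hx0
  exact (h1.inv (norm_ne_zero_iff.2 hx0)).smul hf.contDiffAt

lemma norm_fderiv_inv_norm_sliceProj_smul_add_le {n N : ℕ} (h : N ≤ n)
    {f : EuclideanSpace ℝ (Fin n) → ℂ} {x : EuclideanSpace ℝ (Fin n)}
    (hf : DifferentiableAt ℝ f x) (hx : sliceProj N h x ≠ 0) :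
    ‖fderiv ℝ (fun y => ‖sliceProj N h y‖⁻¹ • f y) x (sliceEmb N h x) + ‖sliceProj N h x‖⁻¹ • f x‖
      ≤ ‖fderiv ℝ f x‖ := by
  have hn : ‖sliceProj N h x‖ ≠ 0 := norm_ne_zero_iff.2 hx
  have hnd : DifferentiableAt ℝ (norm : EuclideanSpace ℝ (Fin N) → ℝ) (sliceProj N h x) :=
    (contDiffAt_norm ℝ hx (n := 1)).differentiableAt one_ne_zero
  have h1 := (hnd.hasFDerivAt.comp x (sliceProj N h).hasFDerivAt)
  have h2 := ((hasDerivAt_inv hn).comp_hasFDerivAt x h1).smul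
    hf.hasFDerivAt
  have h3 : fderiv ℝ (fun y => ‖sliceProj N h y‖⁻¹ • f y) x (sliceEmb N h x)
        + ‖sliceProj N h x‖⁻¹ • f x
      = ‖sliceProj N h x‖⁻¹ • fderiv ℝ f x (sliceEmb N h x) := by
    have h4 := congrArg (fun l => l (sliceEmb N h x)) h2.fderiv
    simp [sliceProj_sliceEmb, hnd.fderiv_norm_self] at h4
    have h5 : (fun y => ‖sliceProj N h y‖⁻¹ • f y) = (((fun y => y⁻¹) ∘ (norm ∘ sliceProj N h)) • f) := rfl
    rw [h5, h4]
    have h6 : (‖sliceProj N h x‖ : ℂ) ≠ 0 := by exact_mod_cast hn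
    simp only [Complex.real_smul, Complex.ofReal_inv]
    field_simp
    ring
  rw [h3, norm_smul, norm_inv, norm_norm]
  have h6 := (fderiv ℝ f x).le_opNorm (sliceEmb N h x)
  rw [norm_sliceEmb] at h6
  rw [inv_mul_le_iff₀ (by positivity)]
  linarith

lemma hardy_sliceNorm {n N : ℕ} (h : N ≤ n) {p : ℝ} (hp1 : 1 < p) (hpN : p < N)
    {f : EuclideanSpace ℝ (Fin n) → ℂ} (hf : ContDiff ℝ (⊤ : ℕ∞) f) (hc : HasCompactSupport f)
    (hs : tsupport f ⊆ {x | sliceProj N h x ≠ 0}) :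
    (∫ x, ‖f x‖ ^ p / sliceNorm N h x ^ p) ^ (1 / p)
      ≤ (p / ((N : ℝ) - p)) * (∫ x, ‖fderiv ℝ f x‖ ^ p) ^ (1 / p) := by
  have hp0 : 0 < p := by linarith
  have hNp : 0 < (N : ℝ) - p := by linarith
  obtain ⟨v, hv⟩ : ∃ v : EuclideanSpace ℝ (Fin n) → ℂ,
      v = fun x => ‖sliceProj N h x‖⁻¹ • f x := ⟨_, rfl⟩
  have hvs : ContDiff ℝ (⊤ : ℕ∞) v := hv ▸ contDiff_inv_norm_sliceProj_smul h hf hs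
  have hvc : HasCompactSupport v :=
    hv ▸ HasCompactSupport.smul_left (f := fun x => ‖sliceProj N h x‖⁻¹) hc
  have hvd : ∀ x, sliceProj N h x ≠ 0 →
      ‖fderiv ℝ v x (sliceEmb N h x) + v x‖ ≤ ‖fderiv ℝ f x‖ := by
    intro x hx
    rw [hv]
    exact norm_fderiv_inv_norm_sliceProj_smul_add_le h (hf.differentiable (by simp) x) hx
  have hu : ContDiff ℝ 1 fun x => ‖v x‖ ^ p := (hvs.of_le (by simp)).norm_rpow hp1
  have huc : HasCompactSupport fun x => ‖v x‖ ^ p :=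
    hvc.comp_left (g := fun z => ‖z‖ ^ p) (by simp [hp0.ne'])
  have hui := hu.continuous.integrable_of_hasCompactSupport huc (μ := volume)
  obtain ⟨hdi, hdiv⟩ := integral_fderiv_sliceEmb h hu huc
  have hcd : Continuous fun x => ‖fderiv ℝ f x‖ := (hf.continuous_fderiv (by simp)).norm
  have hdc : HasCompactSupport fun x => ‖fderiv ℝ f x‖ := (hc.fderiv ℝ).norm
  have hcv : Continuous fun x => ‖v x‖ ^ (p - 1) :=
    hvs.continuous.norm.rpow_const fun x => Or.inr (by linarith)
  have hcvc : HasCompactSupport fun x => ‖v x‖ ^ (p - 1) :=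
    hvc.comp_left (g := fun z => ‖z‖ ^ (p - 1)) (by simp [(sub_pos.2 hp1).ne'])
  have hpt : ∀ x, -(fderiv ℝ (fun x => ‖v x‖ ^ p) x (sliceEmb N h x))
      ≤ p * ‖v x‖ ^ p + p * (‖fderiv ℝ f x‖ * ‖v x‖ ^ (p - 1)) := by
    intro x
    rw [(hvs.differentiable (by simp)).fderiv_norm_rpow hp1]
    by_cases hv0 : v x = 0
    · simp [hv0, hp0.ne', (sub_pos.2 hp1).ne']
    · have hx : sliceProj N h x ≠ 0 := by
        intro h0; apply hv0; simp [hv, h0]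
      have hvp : 0 < ‖v x‖ := norm_pos_iff.2 hv0
      set w := fderiv ℝ v x (sliceEmb N h x) + v x with hw
      have hw' : fderiv ℝ v x (sliceEmb N h x) = w - v x := by simp [hw]
      have hi : |inner ℝ (v x) w| ≤ ‖v x‖ * ‖fderiv ℝ f x‖ :=
        (abs_real_inner_le_norm _ _).trans (by gcongr; exact hvd x hx)
      have e1 : ‖v x‖ ^ p = ‖v x‖ ^ (p - 2) * ‖v x‖ ^ 2 := by
        rw [← Real.rpow_natCast, ← Real.rpow_add hvp]; norm_num
      have e2 : ‖v x‖ ^ (p - 1) = ‖v x‖ ^ (p - 2) * ‖v x‖ := by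
        rw [← Real.rpow_add_one hvp.ne']; ring_nf
      simp only [smul_apply, ContinuousLinearMap.comp_apply, hw',
        innerSL_apply_apply, inner_sub_right, real_inner_self_eq_norm_sq, smul_eq_mul]
      rw [e1, e2]
      have := mul_le_mul_of_nonneg_left (neg_le_of_abs_le hi)
        (show 0 ≤ p * ‖v x‖ ^ (p - 2) by positivity)
      linarith
  have hint : Integrable fun x => ‖fderiv ℝ f x‖ * ‖v x‖ ^ (p - 1) :=
    (hcd.mul hcv).integrable_of_hasCompactSupport hdc.mul_right
  have hmono := integral_mono hdi.neg ((hui.const_mul p).add (hint.const_mul p)) hpt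
  simp only [Pi.neg_apply, Pi.add_apply] at hmono
  rw [integral_neg, hdiv, integral_add (hui.const_mul p) (hint.const_mul p),
    integral_const_mul, integral_const_mul] at hmono
  have hpq : p.HolderConjugate (p / (p - 1)) := Real.HolderConjugate.conjExponent hp1
  have hH := integral_mul_le_Lp_mul_Lq_of_nonneg hpq (μ := volume)
    (f := fun x => ‖fderiv ℝ f x‖) (g := fun x => ‖v x‖ ^ (p - 1))
    (.of_forall fun x => norm_nonneg _) (.of_forall fun x => by positivity)
    (hcd.memLp_of_hasCompactSupport hdc) (hcv.memLp_of_hasCompactSupport hcvc)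
  have e3 : ∀ x, (‖v x‖ ^ (p - 1)) ^ (p / (p - 1)) = ‖v x‖ ^ p := by
    intro x
    rw [← Real.rpow_mul (norm_nonneg _), mul_div_cancel₀ _ (sub_pos.2 hp1).ne']
  have e4 : ∀ x, ‖f x‖ ^ p / sliceNorm N h x ^ p = ‖v x‖ ^ p := by
    intro x
    rw [sliceNorm_eq_norm, ← Real.div_rpow (norm_nonneg _) (norm_nonneg _), hv]
    simp only [norm_smul, norm_inv, norm_norm]
    rw [div_eq_inv_mul]
  simp only [e3] at hH
  simp only [e4]
  set I := ∫ x, ‖v x‖ ^ p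
  set J := (∫ x, ‖fderiv ℝ f x‖ ^ p) ^ (1 / p)
  have hI : 0 ≤ I := integral_nonneg fun x => by positivity
  have hJ : 0 ≤ J := Real.rpow_nonneg (integral_nonneg fun x => by positivity) _
  rcases hI.eq_or_lt with hI0 | hI0
  · rw [← hI0, Real.zero_rpow (by positivity)]
    positivity
  · have e5 : I = I ^ (1 / p) * I ^ (1 / (p / (p - 1))) := by
      rw [← Real.rpow_add hI0]
      have : 1 / p + 1 / (p / (p - 1)) = 1 := by field_simp; ring
      rw [this, Real.rpow_one]
    have hIq : 0 < I ^ (1 / (p / (p - 1))) := by positivity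
    have h7 : ((N : ℝ) - p) * I ≤ p * (J * I ^ (1 / (p / (p - 1)))) := by
      have := mul_le_mul_of_nonneg_left hH hp0.le
      linarith
    rw [div_mul_eq_mul_div, le_div_iff₀ hNp]
    refine le_of_mul_le_mul_right ?_ hIq
    calc I ^ (1 / p) * (N - p) * I ^ (1 / (p / (p - 1)))
        = (N - p) * (I ^ (1 / p) * I ^ (1 / (p / (p - 1)))) := by ring
      _ = (N - p) * I := by rw [← e5]
      _ ≤ _ := by linarith

/-- The linear map `(x', x'') ↦ (s x', t x'')`. -/
noncomputable def sliceDilation (n N : ℕ) (s t : ℝ) :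
    EuclideanSpace ℝ (Fin n) →ₗ[ℝ] EuclideanSpace ℝ (Fin n) :=
  Matrix.toLpLin 2 2 (Matrix.diagonal fun i : Fin n => if (i : ℕ) < N then s else t)

@[simp]
lemma sliceDilation_apply {n N : ℕ} (s t : ℝ) (x : EuclideanSpace ℝ (Fin n)) (i : Fin n) :
    sliceDilation n N s t x i = (if (i : ℕ) < N then s else t) * x i := by
  simp [sliceDilation, Matrix.toLpLin_apply, Matrix.mulVec_diagonal]

lemma det_sliceDilation {n N : ℕ} (h : N ≤ n) (s t : ℝ) :
    LinearMap.det (sliceDilation n N s t) = s ^ N * t ^ (n - N) := by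
  rw [sliceDilation, Matrix.toLpLin_eq_toLin, LinearMap.det_toLin, Matrix.det_diagonal,
    Finset.prod_ite, Finset.prod_const, Finset.prod_const]
  obtain ⟨k, rfl⟩ := Nat.exists_eq_add_of_le h
  congr 2
  · simp [Fin.card_filter_val_lt]
  · rw [Finset.filter_not, Finset.card_sdiff]
    simp [Fin.card_filter_val_lt]

lemma sliceProj_sliceDilation {n N : ℕ} (h : N ≤ n) (s t : ℝ) (x : EuclideanSpace ℝ (Fin n)) :
    sliceProj N h (sliceDilation n N s t x) = s • sliceProj N h x := by
  ext i
  simp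

lemma sliceDilation_eq {n N : ℕ} (h : N ≤ n) (s t : ℝ) (x : EuclideanSpace ℝ (Fin n)) :
    sliceDilation n N s t x = (s - t) • sliceEmb N h x + t • x := by
  ext i
  by_cases hi : (i : ℕ) < N
  · have := congrArg (fun y => y ⟨i, hi⟩) (sliceProj_sliceEmb h x)
    simp only [sliceProj_apply, Fin.castLE_mk, Fin.eta] at this
    simp [hi, this]
    ring
  · have : sliceEmb N h x i = 0 := by
      simp only [sliceEmb, WithLp.ofLp_sum, Finset.sum_apply]
      refine Finset.sum_eq_zero fun j _ => ?_
      have : i ≠ Fin.castLE h j := by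
        rintro rfl
        exact hi (by simp)
      simp [this]
    simp [hi, this]

lemma norm_sliceDilation_le {n N : ℕ} (h : N ≤ n) {s t : ℝ} (hs : 0 ≤ s) (ht : 0 ≤ t)
    (x : EuclideanSpace ℝ (Fin n)) :
    ‖sliceDilation n N s t x‖ ≤ (s + t) * ‖sliceProj N h x‖ + t * ‖x‖ := by
  rw [sliceDilation_eq h]
  refine (norm_add_le _ _).trans ?_
  rw [norm_smul, norm_smul, norm_sliceEmb, Real.norm_of_nonneg ht]
  gcongr
  rw [Real.norm_eq_abs, abs_le]
  constructor <;> linarith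

lemma integral_comp_sliceDilation {n N : ℕ} (h : N ≤ n) {s t : ℝ} (hs : 0 < s) (ht : 0 < t)
    (g : EuclideanSpace ℝ (Fin n) → ℝ) :
    ∫ x, g (sliceDilation n N s t x) = (s ^ N * t ^ (n - N))⁻¹ * ∫ x, g x := by
  have hdet : 0 < LinearMap.det (sliceDilation n N s t) := by
    rw [det_sliceDilation h]; positivity
  have he : MeasurableEmbedding (sliceDilation n N s t) := by
    have : IsUnit (LinearMap.det (sliceDilation n N s t)) := hdet.ne'.isUnit
    exact (LinearEquiv.ofIsUnitDet (v := (EuclideanSpace.basisFun (Fin n) ℝ).toBasis)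
      (v' := (EuclideanSpace.basisFun (Fin n) ℝ).toBasis)
      (f := sliceDilation n N s t) (by simpa using this)
      ).toContinuousLinearEquiv.toHomeomorph.measurableEmbedding
  rw [← he.integral_map, Measure.map_linearMap_addHaar_eq_smul_addHaar _ hdet.ne',
    integral_smul_measure, det_sliceDilation h, ENNReal.toReal_ofReal (abs_nonneg _),
    abs_of_pos (by positivity), smul_eq_mul]

lemma integrable_comp_sliceDilation {n N : ℕ} (h : N ≤ n) {s t : ℝ} (hs : 0 < s) (ht : 0 < t)
    {g : EuclideanSpace ℝ (Fin n) → ℝ} (hg : Integrable g) :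
    Integrable fun x => g (sliceDilation n N s t x) := by
  have hdet : 0 < LinearMap.det (sliceDilation n N s t) := by
    rw [det_sliceDilation h]; positivity
  have hm : Measurable (sliceDilation n N s t) :=
    (LinearMap.continuous_of_finiteDimensional _).measurable
  refine Integrable.comp_measurable (f := sliceDilation n N s t) ?_ hm
  rw [Measure.map_linearMap_addHaar_eq_smul_addHaar _ hdet.ne']
  exact hg.smul_measure ENNReal.ofReal_ne_top

/-- The set of `x` with `e^{-L} ≤ |x'| ≤ e^L` and `|x| ≤ R`. -/
def sliceShell {n N : ℕ} (h : N ≤ n) (L R : ℝ) : Set (EuclideanSpace ℝ (Fin n)) :=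
  {x | Real.exp (-L) ≤ ‖sliceProj N h x‖ ∧ ‖sliceProj N h x‖ ≤ Real.exp L ∧ ‖x‖ ≤ R}

lemma isCompact_sliceShell {n N : ℕ} (h : N ≤ n) (L R : ℝ) : IsCompact (sliceShell h L R) := by
  apply Metric.isCompact_of_isClosed_isBounded
  · have hc : Continuous fun x => ‖sliceProj N h x‖ := (sliceProj N h).continuous.norm
    exact (isClosed_le continuous_const hc).inter
      ((isClosed_le hc continuous_const).inter (isClosed_le continuous_norm continuous_const))
  · refine (Metric.isBounded_closedBall (x := 0) (r := R)).subset fun x hx => ?_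
    simpa using hx.2.2

lemma norm_sliceProj_pos_of_mem {n N : ℕ} {h : N ≤ n} {L R : ℝ} {x : EuclideanSpace ℝ (Fin n)}
    (hx : x ∈ sliceShell h L R) : 0 < ‖sliceProj N h x‖ :=
  (Real.exp_pos _).trans_le hx.1

lemma integrable_indicator_sliceShell {n N : ℕ} (h : N ≤ n) (L R r : ℝ) :
    Integrable ((sliceShell h L R).indicator fun x => ‖sliceProj N h x‖ ^ r) := by
  rw [integrable_indicator_iff (isCompact_sliceShell h L R).measurableSet]
  refine ContinuousOn.integrableOn_compact (isCompact_sliceShell h L R) fun x hx => ?_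
  exact ((sliceProj N h).continuous.norm.continuousAt.rpow_const
    (Or.inl (norm_sliceProj_pos_of_mem hx).ne')).continuousWithinAt

lemma integral_sliceShell_doubling {n N : ℕ} (h : N ≤ n) {L R : ℝ} (hL : 0 ≤ L)
    (hR : 4 * Real.exp (2 * L) ≤ R) :
    ∫ x, (sliceShell h (2 * L) (2 * R)).indicator (fun x => ‖sliceProj N h x‖ ^ (-(N : ℝ))) x
      ≤ 2 * 4 ^ (n - N) *
        ∫ x, (sliceShell h L R).indicator (fun x => ‖sliceProj N h x‖ ^ (-(N : ℝ))) x := by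
  set w : EuclideanSpace ℝ (Fin n) → ℝ :=
    (sliceShell h L R).indicator fun x => ‖sliceProj N h x‖ ^ (-(N : ℝ)) with hw
  have hw0 : ∀ x, 0 ≤ w x := fun x => Set.indicator_nonneg (fun _ _ => by positivity) x
  have hwi : Integrable w := integrable_indicator_sliceShell h L R _
  have hscale : ∀ s : ℝ, 0 < s → ∀ x, sliceDilation n N s 4⁻¹ x ∈ sliceShell h L R →
      ‖sliceProj N h x‖ ^ (-(N : ℝ)) = s ^ N * w (sliceDilation n N s 4⁻¹ x) := by
    intro s hs x hx
    rw [hw, Set.indicator_of_mem hx, sliceProj_sliceDilation, norm_smul,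
      Real.norm_of_nonneg hs.le, Real.mul_rpow hs.le (norm_nonneg _), ← mul_assoc,
      Real.rpow_neg hs.le, Real.rpow_natCast, mul_inv_cancel₀ (by positivity), one_mul]
  have hsI : ∀ s : ℝ, 0 < s → ∫ x, s ^ N * w (sliceDilation n N s 4⁻¹ x)
      = 4 ^ (n - N) * ∫ x, w x := by
    intro s hs
    rw [integral_const_mul, integral_comp_sliceDilation h hs (by norm_num), inv_pow, mul_inv, inv_inv]
    field_simp
  have hsi : ∀ s : ℝ, 0 < s → Integrable fun x => s ^ N * w (sliceDilation n N s 4⁻¹ x) :=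
    fun s hs => (integrable_comp_sliceDilation h hs (by norm_num) hwi).const_mul _
  have hE : Real.exp (-L) ≤ 1 := Real.exp_le_one_iff.2 (by linarith)
  have hE1 : 1 ≤ Real.exp L := Real.one_le_exp hL
  have hE2 : Real.exp (2 * L) = Real.exp L * Real.exp L := by rw [← Real.exp_add]; ring_nf
  have hEi : Real.exp (-L) * Real.exp L = 1 := by rw [← Real.exp_add]; simp
  have hEm2 : Real.exp (-(2 * L)) = Real.exp (-L) * Real.exp (-L) := by
    rw [← Real.exp_add]; ring_nf
  have hEp := Real.exp_pos L
  have hEp' := Real.exp_pos (-L)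
  have hpt : ∀ x, (sliceShell h (2 * L) (2 * R)).indicator
      (fun x => ‖sliceProj N h x‖ ^ (-(N : ℝ))) x
      ≤ Real.exp L ^ N * w (sliceDilation n N (Real.exp L) 4⁻¹ x)
        + Real.exp (-L) ^ N * w (sliceDilation n N (Real.exp (-L)) 4⁻¹ x) := by
    intro x
    have h1 : 0 ≤ Real.exp L ^ N * w (sliceDilation n N (Real.exp L) 4⁻¹ x) :=
      mul_nonneg (by positivity) (hw0 _)
    have h2 : 0 ≤ Real.exp (-L) ^ N * w (sliceDilation n N (Real.exp (-L)) 4⁻¹ x) :=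
      mul_nonneg (by positivity) (hw0 _)
    refine Set.indicator_apply_le' (fun hx => ?_) (fun _ => add_nonneg h1 h2)
    obtain ⟨ha, hb, hc⟩ := hx
    rcases le_total ‖sliceProj N h x‖ 1 with hx1 | hx1
    · rw [hscale _ hEp x ?_]
      · linarith
      refine ⟨?_, ?_, (norm_sliceDilation_le h hEp.le (by norm_num) x).trans ?_⟩
      · rw [sliceProj_sliceDilation, norm_smul, Real.norm_of_nonneg hEp.le]
        nlinarith
      · rw [sliceProj_sliceDilation, norm_smul, Real.norm_of_nonneg hEp.le]
        nlinarith
      · nlinarith [norm_nonneg (sliceProj N h x)]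
    · rw [hscale _ hEp' x ?_]
      · linarith
      refine ⟨?_, ?_, (norm_sliceDilation_le h hEp'.le (by norm_num) x).trans ?_⟩
      · rw [sliceProj_sliceDilation, norm_smul, Real.norm_of_nonneg hEp'.le]
        nlinarith
      · rw [sliceProj_sliceDilation, norm_smul, Real.norm_of_nonneg hEp'.le]
        nlinarith
      · nlinarith [norm_nonneg (sliceProj N h x)]
  calc _ ≤ ∫ x, (Real.exp L ^ N * w (sliceDilation n N (Real.exp L) 4⁻¹ x)
        + Real.exp (-L) ^ N * w (sliceDilation n N (Real.exp (-L)) 4⁻¹ x)) :=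
        integral_mono (integrable_indicator_sliceShell h _ _ _)
          ((hsi _ hEp).add (hsi _ hEp')) hpt
    _ = _ := by
        rw [integral_add (hsi _ hEp) (hsi _ hEp'), hsI _ hEp, hsI _ hEp']
        ring

lemma integral_rpow_add_le {α : Type*} [MeasurableSpace α] {μ : Measure α} {p : ℝ} (hp : 1 ≤ p)
    {g u v : α → ℝ} (hg : ∀ x, 0 ≤ g x) (hgle : ∀ x, g x ≤ u x + v x)
    (hu : MemLp u (ENNReal.ofReal p) μ) (hv : MemLp v (ENNReal.ofReal p) μ)
    (hu0 : ∀ x, 0 ≤ u x) (hv0 : ∀ x, 0 ≤ v x) :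
    (∫ x, g x ^ p ∂μ) ^ (1 / p)
      ≤ (∫ x, u x ^ p ∂μ) ^ (1 / p) + (∫ x, v x ^ p ∂μ) ^ (1 / p) := by
  have hp0 : 0 < p := by linarith
  have hpne : ENNReal.ofReal p ≠ 0 := by simpa using hp0
  have hpr : (ENNReal.ofReal p).toReal = p := ENNReal.toReal_ofReal hp0.le
  have key : ∀ z : α → ℝ, MemLp z (ENNReal.ofReal p) μ → (∀ x, 0 ≤ z x) →
      eLpNorm z (ENNReal.ofReal p) μ = ENNReal.ofReal ((∫ x, z x ^ p ∂μ) ^ (1 / p)) := by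
    intro z hz hz0
    rw [hz.eLpNorm_eq_integral_rpow_norm hpne ENNReal.ofReal_ne_top, hpr, one_div]
    simp only [fun x => Real.norm_of_nonneg (hz0 x)]
  have hI : ∀ z : α → ℝ, (∀ x, 0 ≤ z x) → 0 ≤ ∫ x, z x ^ p ∂μ := fun z hz =>
    integral_nonneg fun x => Real.rpow_nonneg (hz x) _
  have huv0 : ∀ x, 0 ≤ (u + v) x := fun x => add_nonneg (hu0 x) (hv0 x)
  have h1 := eLpNorm_add_le hu.1 hv.1 (p := ENNReal.ofReal p) (by simpa using hp)
  rw [key _ (hu.add hv) huv0, key _ hu hu0, key _ hv hv0,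
    ← ENNReal.ofReal_add (Real.rpow_nonneg (hI _ hu0) _) (Real.rpow_nonneg (hI _ hv0) _),
    ENNReal.ofReal_le_ofReal_iff
      (add_nonneg (Real.rpow_nonneg (hI _ hu0) _) (Real.rpow_nonneg (hI _ hv0) _))] at h1
  refine (Real.rpow_le_rpow (hI _ hg) ?_ (by positivity)).trans h1
  refine integral_mono_of_nonneg (.of_forall fun x => Real.rpow_nonneg (hg x) _) ?_
    (.of_forall fun x => Real.rpow_le_rpow (hg x) (hgle x) hp0.le)
  have := (hu.add hv).integrable_norm_rpow hpne ENNReal.ofReal_ne_top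
  rw [hpr] at this
  simpa only [fun x => Real.norm_of_nonneg (huv0 x)] using this

/-- The truncation `|x'|^{-a} φ(log |x'| / L) χ(x / R)` of the power `|x'|^{-a}`. -/
noncomputable def truncatedPower {n N : ℕ} (h : N ≤ n) (φ : ContDiffBump (0 : ℝ))
    (χ : ContDiffBump (0 : EuclideanSpace ℝ (Fin n))) (a L R : ℝ) (x : EuclideanSpace ℝ (Fin n)) :
    ℝ :=
  ‖sliceProj N h x‖ ^ (-a) * φ (Real.log ‖sliceProj N h x‖ / L) * χ (R⁻¹ • x)

section TruncatedPower

variable {n N : ℕ} (h : N ≤ n) {φ : ContDiffBump (0 : ℝ)}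
  {χ : ContDiffBump (0 : EuclideanSpace ℝ (Fin n))} {a L R : ℝ}

lemma truncatedPower_nonneg (x : EuclideanSpace ℝ (Fin n)) :
    0 ≤ truncatedPower h φ χ a L R x :=
  mul_nonneg (mul_nonneg (by positivity) φ.nonneg) χ.nonneg

lemma tsupport_truncatedPower_subset (hφ : φ.rOut = 2) (hχ : χ.rOut = 2) (ha : 0 < a)
    (hL : 0 < L) (hR : 0 < R) :
    tsupport (truncatedPower h φ χ a L R) ⊆ sliceShell h (2 * L) (2 * R) := by
  refine closure_minimal (fun x hx => ?_) (isCompact_sliceShell h _ _).isClosed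
  obtain ⟨⟨h1, h2⟩, h3⟩ : (‖sliceProj N h x‖ ^ (-a) ≠ 0 ∧
      φ (Real.log ‖sliceProj N h x‖ / L) ≠ 0) ∧ χ (R⁻¹ • x) ≠ 0 := by
    simpa [truncatedPower] using hx
  have hpos : 0 < ‖sliceProj N h x‖ := by
    refine (norm_nonneg _).lt_of_ne' fun h0 => h1 ?_
    rw [h0, Real.zero_rpow (by linarith)]
  have h4 : Real.log ‖sliceProj N h x‖ / L ∈ Metric.ball (0 : ℝ) 2 := by
    rw [← hφ, ← φ.support_eq]; exact h2
  have h5 : R⁻¹ • x ∈ Metric.ball (0 : EuclideanSpace ℝ (Fin n)) 2 := by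
    rw [← hχ, ← χ.support_eq]; exact h3
  rw [mem_ball_zero_iff, Real.norm_eq_abs, abs_lt, lt_div_iff₀ hL, div_lt_iff₀ hL] at h4
  rw [mem_ball_zero_iff, norm_smul, norm_inv, Real.norm_of_nonneg hR.le,
    inv_mul_lt_iff₀ hR] at h5
  refine ⟨(Real.le_log_iff_exp_le hpos).1 (by linarith), (Real.log_le_iff_le_exp hpos).1 h4.2.le,
    by linarith⟩

lemma truncatedPower_eq_of_mem (hφ : φ.rIn = 1) (hχ : χ.rIn = 1) (hL : 0 < L) (hR : 0 < R)
    {x : EuclideanSpace ℝ (Fin n)} (hx : x ∈ sliceShell h L R) :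
    truncatedPower h φ χ a L R x = ‖sliceProj N h x‖ ^ (-a) := by
  have hpos := norm_sliceProj_pos_of_mem hx
  obtain ⟨h1, h2, h3⟩ := hx
  rw [truncatedPower, φ.one_of_mem_closedBall, χ.one_of_mem_closedBall, mul_one, mul_one]
  · rw [hχ, mem_closedBall_zero_iff, norm_smul, norm_inv, Real.norm_of_nonneg hR.le,
      inv_mul_le_iff₀ hR]
    linarith
  · rw [hφ, mem_closedBall_zero_iff, Real.norm_eq_abs, abs_le, le_div_iff₀ hL, div_le_iff₀ hL]
    have := (Real.le_log_iff_exp_le hpos).2 h1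
    have := (Real.log_le_iff_le_exp hpos).2 h2
    constructor <;> linarith

lemma contDiff_truncatedPower (hφ : φ.rOut = 2) (hχ : χ.rOut = 2) (ha : 0 < a)
    (hL : 0 < L) (hR : 0 < R) : ContDiff ℝ (⊤ : ℕ∞) (truncatedPower h φ χ a L R) := by
  refine contDiff_of_forall_mem_tsupport fun x hx => ?_
  have hpos := norm_sliceProj_pos_of_mem (tsupport_truncatedPower_subset h hφ hχ ha hL hR hx)
  have h1 : ContDiffAt ℝ (⊤ : ℕ∞) (fun y => ‖sliceProj N h y‖) x :=
    (sliceProj N h).contDiff.contDiffAt.norm ℝ (norm_pos_iff.1 hpos)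
  have h2 : ContDiffAt ℝ (⊤ : ℕ∞) (fun y => φ (Real.log ‖sliceProj N h y‖ / L)) x :=
    φ.contDiff.contDiffAt.comp x ((h1.log hpos.ne').div_const L)
  have h3 : ContDiffAt ℝ (⊤ : ℕ∞) (fun y => χ (R⁻¹ • y)) x :=
    (χ.contDiff.comp (contDiff_id.const_smul R⁻¹)).contDiffAt
  exact ((h1.rpow_const_of_ne hpos.ne').mul h2).mul h3

lemma norm_fderiv_truncatedPower_le (hφ : φ.rOut = 2) (hχ : χ.rOut = 2) (ha : 0 < a)
    (hL : 1 ≤ L) (hR : 4 * L * Real.exp (2 * L) ≤ R) {M₁ M₂ : ℝ} (hM₁ : ∀ t, |deriv φ t| ≤ M₁)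
    (hM₂ : ∀ x, ‖fderiv ℝ χ x‖ ≤ M₂) (x : EuclideanSpace ℝ (Fin n)) :
    ‖fderiv ℝ (truncatedPower h φ χ a L R) x‖
      ≤ a * (‖sliceProj N h x‖⁻¹ * truncatedPower h φ χ a L R x)
        + (M₁ + M₂) / L * (sliceShell h (2 * L) (2 * R)).indicator
            (fun x => ‖sliceProj N h x‖ ^ (-a - 1)) x := by
  have hL0 : 0 < L := by linarith
  have hR0 : 0 < R := lt_of_lt_of_le (by positivity) hR
  have hM₁0 : 0 ≤ M₁ := (abs_nonneg _).trans (hM₁ 0)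
  have hM₂0 : 0 ≤ M₂ := (norm_nonneg _).trans (hM₂ 0)
  by_cases hx : x ∈ sliceShell h (2 * L) (2 * R)
  swap
  · have : fderiv ℝ (truncatedPower h φ χ a L R) x = 0 := by
      by_contra hne
      exact hx (tsupport_truncatedPower_subset h hφ hχ ha hL0 hR0
        (support_fderiv_subset ℝ hne))
    rw [this, Set.indicator_of_notMem hx, norm_zero, mul_zero, add_zero]
    exact mul_nonneg ha.le (mul_nonneg (by positivity) (truncatedPower_nonneg h x))
  have hpos := norm_sliceProj_pos_of_mem hx
  have hx0 : sliceProj N h x ≠ 0 := norm_pos_iff.1 hpos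
  have hnd : DifferentiableAt ℝ (norm : EuclideanSpace ℝ (Fin N) → ℝ) (sliceProj N h x) :=
    (contDiffAt_norm ℝ hx0 (n := 1)).differentiableAt one_ne_zero
  obtain ⟨D, hD⟩ : DifferentiableAt ℝ (fun y => ‖sliceProj N h y‖) x :=
    hnd.comp x (sliceProj N h).differentiableAt
  have hD1 : ‖D‖ ≤ 1 := by
    have hlip : LipschitzWith 1 fun y => ‖sliceProj N h y‖ := by
      refine LipschitzWith.of_dist_le_mul fun y z => ?_
      rw [NNReal.coe_one, one_mul, dist_eq_norm, dist_eq_norm]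
      refine (abs_norm_sub_norm_le _ _).trans ?_
      rw [← map_sub]
      exact norm_sliceProj_le h _
    simpa using hD.le_of_lipschitz hlip
  set r := ‖sliceProj N h x‖ with hr
  have hg : HasDerivAt (fun s : ℝ => s ^ (-a) * φ (Real.log s / L))
      (-a * r ^ (-a - 1) * φ (Real.log r / L)
        + r ^ (-a) * (deriv φ (Real.log r / L) * (r⁻¹ / L))) r := by
    have hφd : HasDerivAt φ (deriv φ (Real.log r / L)) (Real.log r / L) :=
      ((φ.contDiff (n := 1)).differentiable one_ne_zero _).hasDerivAt
    have hφl : HasDerivAt (fun s : ℝ => φ (Real.log s / L))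
        (deriv φ (Real.log r / L) * (r⁻¹ / L)) r :=
      HasDerivAt.comp (h₂ := φ) (h := fun s => Real.log s / L) r hφd
        ((Real.hasDerivAt_log hpos.ne').div_const L)
    exact (Real.hasDerivAt_rpow_const (Or.inl hpos.ne')).mul hφl
  have hχd : HasFDerivAt (fun y => χ (R⁻¹ • y)) (R⁻¹ • fderiv ℝ χ (R⁻¹ • x)) x := by
    have h1 : HasFDerivAt χ (fderiv ℝ χ (R⁻¹ • x)) (R⁻¹ • x) :=
      ((χ.contDiff (n := 1)).differentiable one_ne_zero _).hasFDerivAt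
    have h2 := h1.comp x ((hasFDerivAt_id x).const_smul R⁻¹)
    simpa [Function.comp_def] using h2
  have hfd := (hg.comp_hasFDerivAt x hD).mul hχd
  have hfd' : fderiv ℝ (truncatedPower h φ χ a L R) x = _ := hfd.fderiv
  rw [hfd', Set.indicator_of_mem hx]
  have hra : r ^ (-a) = r * r ^ (-a - 1) := by
    rw [Real.rpow_sub_one hpos.ne']
    field_simp
  have hq : 0 < r ^ (-a - 1) := by positivity
  have hφ0 : 0 ≤ φ (Real.log r / L) := φ.nonneg
  have hφ1 : φ (Real.log r / L) ≤ 1 := φ.le_one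
  have hχ0 : 0 ≤ χ (R⁻¹ • x) := χ.nonneg
  have hχ1 : χ (R⁻¹ • x) ≤ 1 := χ.le_one
  have hrR : r / R ≤ 1 / L := by
    rw [div_le_div_iff₀ hR0 hL0]
    have := hx.2.1
    have h2 : r * L ≤ Real.exp (2 * L) * L := by gcongr
    have h3 : 0 < Real.exp (2 * L) * L := by positivity
    linarith
  have hsmall : r ^ (-a) * φ (Real.log r / L) * (R⁻¹ * M₂) ≤ M₂ / L * r ^ (-a - 1) := by
    calc r ^ (-a) * φ (Real.log r / L) * (R⁻¹ * M₂)
        ≤ r ^ (-a) * 1 * (R⁻¹ * M₂) := by gcongr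
      _ = M₂ * r ^ (-a - 1) * (r / R) := by rw [hra]; ring
      _ ≤ M₂ * r ^ (-a - 1) * (1 / L) := by gcongr
      _ = _ := by ring
  have hgb : |(-a * r ^ (-a - 1) * φ (Real.log r / L)
        + r ^ (-a) * (deriv φ (Real.log r / L) * (r⁻¹ / L)))|
      ≤ a * r ^ (-a - 1) * φ (Real.log r / L) + M₁ / L * r ^ (-a - 1) := by
    have e : r ^ (-a) * (deriv φ (Real.log r / L) * (r⁻¹ / L))
        = deriv φ (Real.log r / L) / L * r ^ (-a - 1) := by
      rw [hra]; field_simp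
    rw [e]
    refine (abs_add_le _ _).trans (add_le_add (le_of_eq ?_) ?_)
    · rw [abs_mul, abs_mul, abs_neg, abs_of_pos ha, abs_of_pos hq, abs_of_nonneg hφ0]
    · rw [abs_mul, abs_div, abs_of_pos hL0, abs_of_pos hq]
      gcongr
      exact hM₁ _
  have htp : truncatedPower h φ χ a L R x
      = r * r ^ (-a - 1) * φ (Real.log r / L) * χ (R⁻¹ • x) := by
    rw [← hra]; rfl
  rw [htp]
  refine (norm_add_le _ _).trans ?_
  simp only [norm_smul, Function.comp_apply, Real.norm_eq_abs, ← hr]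
  rw [abs_of_nonneg (show 0 ≤ r ^ (-a) * φ (Real.log r / L) by positivity), abs_of_nonneg hχ0,
    abs_of_pos (inv_pos.2 hR0)]
  have t1 : r ^ (-a) * φ (Real.log r / L) * (R⁻¹ * ‖fderiv ℝ χ (R⁻¹ • x)‖)
      ≤ M₂ / L * r ^ (-a - 1) := by
    refine le_trans ?_ hsmall
    gcongr
    exact hM₂ _
  have t2 : χ (R⁻¹ • x) * (|(-a * r ^ (-a - 1) * φ (Real.log r / L)
        + r ^ (-a) * (deriv φ (Real.log r / L) * (r⁻¹ / L)))| * ‖D‖)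
      ≤ a * r ^ (-a - 1) * φ (Real.log r / L) * χ (R⁻¹ • x) + M₁ / L * r ^ (-a - 1) := by
    calc _ ≤ χ (R⁻¹ • x) * ((a * r ^ (-a - 1) * φ (Real.log r / L)
          + M₁ / L * r ^ (-a - 1)) * 1) := by gcongr
      _ = a * r ^ (-a - 1) * φ (Real.log r / L) * χ (R⁻¹ • x)
          + χ (R⁻¹ • x) * (M₁ / L * r ^ (-a - 1)) := by ring
      _ ≤ _ := by
        have hB : 0 ≤ M₁ / L * r ^ (-a - 1) := mul_nonneg (div_nonneg hM₁0 hL0.le) hq.le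
        have := mul_le_of_le_one_left hB hχ1
        linarith
  refine (add_le_add t1 t2).trans (le_of_eq ?_)
  field_simp
  ring

lemma truncatedPower_Lp_bounds (hφ : φ.rIn = 1) (hφ' : φ.rOut = 2) (hχ : χ.rIn = 1)
    (hχ' : χ.rOut = 2) {p : ℝ} (hp1 : 1 < p) (hpN : p < N) (ha : a = (N - p) / p)
    (hL : 1 ≤ L) (hR : 4 * L * Real.exp (2 * L) ≤ R) {M₁ M₂ : ℝ} (hM₁ : ∀ t, |deriv φ t| ≤ M₁)
    (hM₂ : ∀ x, ‖fderiv ℝ χ x‖ ≤ M₂) :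
    (∫ x, ‖fderiv ℝ (truncatedPower h φ χ a L R) x‖ ^ p) ^ (1 / p)
      ≤ (a + (M₁ + M₂) / L * (2 * 4 ^ (n - N)) ^ (1 / p)) *
        (∫ x, (‖sliceProj N h x‖⁻¹ * truncatedPower h φ χ a L R x) ^ p) ^ (1 / p) := by
  have hp0 : 0 < p := by linarith
  have ha0 : 0 < a := by rw [ha]; exact div_pos (by linarith) hp0
  have hL0 : 0 < L := by linarith
  have hR0 : 0 < R := lt_of_lt_of_le (by positivity) hR
  have hM₁0 : 0 ≤ M₁ := (abs_nonneg _).trans (hM₁ 0)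
  have hM₂0 : 0 ≤ M₂ := (norm_nonneg _).trans (hM₂ 0)
  have hpne : ENNReal.ofReal p ≠ 0 := by simpa using hp0
  have hap : (-a - 1) * p = -(N : ℝ) := by rw [ha]; field_simp; ring
  set F : EuclideanSpace ℝ (Fin n) → ℝ :=
    fun x => ‖sliceProj N h x‖⁻¹ * truncatedPower h φ χ a L R x with hF
  set W : EuclideanSpace ℝ (Fin n) → ℝ := (sliceShell h (2 * L) (2 * R)).indicator
    (fun x => ‖sliceProj N h x‖ ^ (-a - 1)) with hW
  have hF0 : ∀ x, 0 ≤ F x := fun x => mul_nonneg (by positivity) (truncatedPower_nonneg h x)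
  have hW0 : ∀ x, 0 ≤ W x := fun x => Set.indicator_nonneg (fun _ _ => by positivity) x
  have hsupp := tsupport_truncatedPower_subset h hφ' hχ' ha0 hL0 hR0
  have hFc : Continuous F := by
    refine (contDiff_of_forall_mem_tsupport (k := 0) fun x hx => ?_).continuous
    have hpos := norm_sliceProj_pos_of_mem (hsupp (tsupport_mul_subset_right hx))
    have h1 : ContDiffAt ℝ 0 (fun y => ‖sliceProj N h y‖) x :=
      (sliceProj N h).contDiff.contDiffAt.norm ℝ (norm_pos_iff.1 hpos)
    exact (h1.inv hpos.ne').mul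
      ((contDiff_truncatedPower h hφ' hχ' ha0 hL0 hR0).of_le (by simp)).contDiffAt
  have hFs : HasCompactSupport F := HasCompactSupport.mul_left
    ((isCompact_sliceShell h _ _).of_isClosed_subset (isClosed_tsupport _) hsupp)
  have hFm : MemLp F (ENNReal.ofReal p) := hFc.memLp_of_hasCompactSupport hFs
  have hWp : ∀ x, W x ^ p = (sliceShell h (2 * L) (2 * R)).indicator
      (fun x => ‖sliceProj N h x‖ ^ (-(N : ℝ))) x := by
    intro x
    by_cases hx : x ∈ sliceShell h (2 * L) (2 * R)
    · simp only [hW, Set.indicator_of_mem hx]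
      rw [← Real.rpow_mul (norm_nonneg _), hap]
    · simp only [hW, Set.indicator_of_notMem hx]
      exact Real.zero_rpow hp0.ne'
  have hWm : MemLp W (ENNReal.ofReal p) := by
    rw [← integrable_norm_rpow_iff (f := W) (integrable_indicator_sliceShell h _ _ _).1 hpne
      ENNReal.ofReal_ne_top, ENNReal.toReal_ofReal hp0.le]
    simp only [fun x => Real.norm_of_nonneg (hW0 x), hWp]
    exact integrable_indicator_sliceShell h _ _ _
  have hFp : Integrable fun x => F x ^ p := by
    have := hFm.integrable_norm_rpow hpne ENNReal.ofReal_ne_top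
    rw [ENNReal.toReal_ofReal hp0.le] at this
    simpa only [fun x => Real.norm_of_nonneg (hF0 x)] using this
  have hdoub : ∫ x, W x ^ p ≤ 2 * 4 ^ (n - N) * ∫ x, F x ^ p := by
    simp only [hWp]
    have hR' : 4 * Real.exp (2 * L) ≤ R := by
      refine le_trans ?_ hR
      gcongr
      linarith
    refine (integral_sliceShell_doubling h hL0.le hR').trans ?_
    refine mul_le_mul_of_nonneg_left ?_ (by positivity)
    refine integral_mono (integrable_indicator_sliceShell h _ _ _) hFp fun x => ?_
    refine Set.indicator_apply_le' (fun hx => ?_) fun _ => Real.rpow_nonneg (hF0 x) _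
    have hpos := norm_sliceProj_pos_of_mem hx
    simp only [hF]
    rw [truncatedPower_eq_of_mem h hφ hχ hL0 hR0 hx, ← Real.rpow_neg_one, ← Real.rpow_add hpos,
      ← Real.rpow_mul hpos.le, ← hap]
    exact le_of_eq (by ring_nf)
  have hsc : ∀ (c : ℝ) (z : EuclideanSpace ℝ (Fin n) → ℝ), 0 ≤ c → (∀ x, 0 ≤ z x) →
      (∫ x, (c * z x) ^ p) ^ (1 / p) = c * (∫ x, z x ^ p) ^ (1 / p) := by
    intro c z hc hz
    simp only [fun x => Real.mul_rpow (z := p) hc (hz x)]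
    rw [integral_const_mul, Real.mul_rpow (by positivity)
      (integral_nonneg fun x => Real.rpow_nonneg (hz x) _), ← Real.rpow_mul hc,
      mul_one_div_cancel hp0.ne', Real.rpow_one]
  have hc : 0 ≤ (M₁ + M₂) / L := by positivity
  have hmink := integral_rpow_add_le (μ := volume) hp1.le
    (g := fun x => ‖fderiv ℝ (truncatedPower h φ χ a L R) x‖)
    (u := fun x => a * F x) (v := fun x => (M₁ + M₂) / L * W x) (fun x => norm_nonneg _)
    (norm_fderiv_truncatedPower_le h hφ' hχ' ha0 hL hR hM₁ hM₂)
    (hFm.const_mul a) (hWm.const_mul _) (fun x => mul_nonneg ha0.le (hF0 x))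
    (fun x => mul_nonneg hc (hW0 x))
  rw [hsc _ _ ha0.le hF0, hsc _ _ hc hW0] at hmink
  refine hmink.trans ?_
  have hFI : 0 ≤ ∫ x, F x ^ p := integral_nonneg fun x => Real.rpow_nonneg (hF0 x) _
  have h1 : (∫ x, W x ^ p) ^ (1 / p)
      ≤ (2 * 4 ^ (n - N)) ^ (1 / p) * (∫ x, F x ^ p) ^ (1 / p) := by
    rw [← Real.mul_rpow (by positivity) hFI]
    exact Real.rpow_le_rpow (integral_nonneg fun x => Real.rpow_nonneg (hW0 x) _) hdoub
      (by positivity)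
  have h2 := mul_le_mul_of_nonneg_left h1 hc
  linarith

end TruncatedPower

lemma exists_lt_hardy_sliceNorm {n N : ℕ} (h : N ≤ n) {p C : ℝ} (hp1 : 1 < p) (hpN : p < N)
    (hC : C < p / ((N : ℝ) - p)) :
    ∃ f : EuclideanSpace ℝ (Fin n) → ℂ,
      ContDiff ℝ (⊤ : ℕ∞) f ∧ HasCompactSupport f ∧
      tsupport f ⊆ {x | sliceProj N h x ≠ 0} ∧ f ≠ 0 ∧
      C * (∫ x, ‖fderiv ℝ f x‖ ^ p) ^ (1 / p)
        < (∫ x, ‖f x‖ ^ p / sliceNorm N h x ^ p) ^ (1 / p) := by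
  have hp0 : 0 < p := by linarith
  have hNp : 0 < (N : ℝ) - p := by linarith
  have hN : 0 < N := by
    have : (0 : ℝ) < N := by linarith
    exact_mod_cast this
  obtain ⟨a, ha⟩ : ∃ a : ℝ, a = (N - p) / p := ⟨_, rfl⟩
  have ha0 : 0 < a := by rw [ha]; positivity
  let φ : ContDiffBump (0 : ℝ) := ⟨1, 2, one_pos, one_lt_two⟩
  let χ : ContDiffBump (0 : EuclideanSpace ℝ (Fin n)) := ⟨1, 2, one_pos, one_lt_two⟩
  obtain ⟨M₁, hM₁⟩ := ((φ.contDiff (n := 1)).continuous_deriv_one).bounded_above_of_compact_support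
    φ.hasCompactSupport.deriv
  obtain ⟨M₂, hM₂⟩ := ((χ.contDiff (n := 1)).continuous_fderiv
    one_ne_zero).bounded_above_of_compact_support (χ.hasCompactSupport.fderiv ℝ)
  obtain ⟨K, hK⟩ : ∃ K : ℝ, K = (M₁ + M₂) * (2 * 4 ^ (n - N)) ^ (1 / p) := ⟨_, rfl⟩
  have hCa : C * a < 1 := by
    rw [lt_div_iff₀ hNp] at hC
    rw [ha, mul_div_assoc', div_lt_one hp0]
    exact hC
  obtain ⟨L, hL⟩ : ∃ L : ℝ, 1 ≤ L ∧ C * K / (1 - C * a) < L :=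
    ⟨max 1 (C * K / (1 - C * a) + 1), le_max_left _ _,
      (lt_add_one _).trans_le (le_max_right _ _)⟩
  obtain ⟨hL1, hL2⟩ := hL
  have hL0 : 0 < L := by linarith
  set R := 4 * L * Real.exp (2 * L) with hR
  have hR0 : 0 < R := by positivity
  set g := truncatedPower h φ χ a L R with hg
  have hgs : ContDiff ℝ (⊤ : ℕ∞) g := contDiff_truncatedPower h rfl rfl ha0 hL0 hR0
  have hsupp : tsupport g ⊆ sliceShell h (2 * L) (2 * R) :=
    tsupport_truncatedPower_subset h rfl rfl ha0 hL0 hR0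
  have hgc : HasCompactSupport g :=
    (isCompact_sliceShell h _ _).of_isClosed_subset (isClosed_tsupport _) hsupp
  have hfsupp : tsupport (fun x => (g x : ℂ)) ⊆ {x | sliceProj N h x ≠ 0} := fun x hx =>
    norm_pos_iff.1 (norm_sliceProj_pos_of_mem
      (hsupp (tsupport_comp_subset (g := fun t : ℝ => (t : ℂ)) Complex.ofReal_zero g hx)))
  have hfs : ContDiff ℝ (⊤ : ℕ∞) fun x => (g x : ℂ) := Complex.ofRealCLM.contDiff.comp hgs
  have hfc : HasCompactSupport fun x => (g x : ℂ) :=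
    hgc.comp_left (g := fun t : ℝ => (t : ℂ)) Complex.ofReal_zero
  have hf0 : (fun x => (g x : ℂ)) ≠ 0 := by
    intro h0
    have h1 : ‖sliceProj N h (EuclideanSpace.single ⟨0, by omega⟩ 1)‖ = 1 := by
      have : sliceProj N h (EuclideanSpace.single ⟨0, by omega⟩ 1)
          = EuclideanSpace.single ⟨0, hN⟩ 1 := by
        ext i
        simp [Fin.ext_iff]
      rw [this]
      simp
    have h2 : EuclideanSpace.single ⟨0, by omega⟩ 1 ∈ sliceShell h L R := by
      refine ⟨?_, ?_, ?_⟩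
      · rw [h1]; exact Real.exp_le_one_iff.2 (by linarith)
      · rw [h1]; exact Real.one_le_exp hL0.le
      · have : 1 ≤ Real.exp (2 * L) := Real.one_le_exp (by linarith)
        have : 1 ≤ R := by rw [hR]; nlinarith
        simpa using this
    have h3 := congrFun h0 (EuclideanSpace.single ⟨0, by omega⟩ 1)
    rw [hg, truncatedPower_eq_of_mem h rfl rfl hL0 hR0 h2, h1] at h3
    simp at h3
  refine ⟨fun x => (g x : ℂ), hfs, hfc, hfsupp, hf0, ?_⟩
  have hd : ∀ x, fderiv ℝ (fun x => (g x : ℂ)) x = Complex.ofRealCLM.comp (fderiv ℝ g x) :=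
    fun x => (Complex.ofRealCLM.hasFDerivAt.comp x
      (hgs.differentiable (by simp) x).hasFDerivAt).fderiv
  have hdn : ∀ x, ‖fderiv ℝ (fun x => (g x : ℂ)) x‖ = ‖fderiv ℝ g x‖ := by
    intro x
    rw [hd]
    exact Complex.ofRealLI.norm_toContinuousLinearMap_comp
  have he : ∀ x, ‖(g x : ℂ)‖ ^ p / sliceNorm N h x ^ p = (‖sliceProj N h x‖⁻¹ * g x) ^ p := by
    intro x
    rw [sliceNorm_eq_norm, ← Real.div_rpow (norm_nonneg _) (norm_nonneg _), Complex.norm_real,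
      Real.norm_of_nonneg (truncatedPower_nonneg h x), div_eq_inv_mul]
  have hpos : 0 < (∫ x, (‖sliceProj N h x‖⁻¹ * g x) ^ p) ^ (1 / p) := by
    apply Real.rpow_pos_of_pos
    have hF0 : ∀ x, 0 ≤ ‖sliceProj N h x‖⁻¹ * g x := fun x =>
      mul_nonneg (by positivity) (truncatedPower_nonneg h x)
    have hv := contDiff_inv_norm_sliceProj_smul h hfs hfsupp
    have hvn : ∀ x, ‖‖sliceProj N h x‖⁻¹ • (g x : ℂ)‖ = ‖sliceProj N h x‖⁻¹ * g x := by
      intro x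
      rw [norm_smul, norm_inv, norm_norm, Complex.norm_real,
        Real.norm_of_nonneg (truncatedPower_nonneg h x)]
    obtain ⟨x, hx⟩ := Function.ne_iff.1 hf0
    have hgx : g x ≠ 0 := by simpa using hx
    have hFc : Continuous fun x => ‖sliceProj N h x‖⁻¹ * g x := by
      simpa only [hvn] using hv.continuous.norm
    refine (hFc.rpow_const fun _ => Or.inr hp0.le).integral_pos_of_hasCompactSupport_nonneg_nonzero
      ((HasCompactSupport.mul_left hgc).comp_left (g := fun t : ℝ => t ^ p)
        (Real.zero_rpow hp0.ne')) (fun x => Real.rpow_nonneg (hF0 x) _) (x := x) ?_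
    have hPx : ‖sliceProj N h x‖ ≠ 0 :=
      (norm_sliceProj_pos_of_mem (hsupp (subset_tsupport _ hgx))).ne'
    exact (Real.rpow_pos_of_pos ((hF0 x).lt_of_ne' (mul_ne_zero (inv_ne_zero hPx) hgx)) _).ne'
  have hb := truncatedPower_Lp_bounds h (φ := φ) (χ := χ) rfl rfl rfl rfl hp1 hpN ha hL1 hR.ge
    hM₁ hM₂
  simp only [hdn, he]
  rcases le_or_gt C 0 with hC0 | hC0
  · refine lt_of_le_of_lt (mul_nonpos_of_nonpos_of_nonneg hC0 ?_) hpos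
    exact Real.rpow_nonneg (integral_nonneg fun x => by positivity) _
  · refine (mul_le_mul_of_nonneg_left hb hC0.le).trans_lt ?_
    rw [← mul_assoc]
    refine mul_lt_of_lt_one_left hpos ?_
    have e : C * (a + (M₁ + M₂) / L * (2 * 4 ^ (n - N)) ^ (1 / p)) = C * a + C * K / L := by
      rw [hK]; ring
    rw [e]
    rw [div_lt_iff₀ (by linarith)] at hL2
    have : C * K / L < 1 - C * a := by
      rw [div_lt_iff₀ hL0]
      linarith
    linarith

/-- Badiale–Tarantello conjecture: `p/(N-p)` is the best constant in the inequality
`‖f/|x'|‖_{L^p(ℝⁿ)} ≤ C ‖∇f‖_{L^p(ℝⁿ)}`. -/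
theorem stmt4 (n N : ℕ) (hN : 2 ≤ N) (hNn : N ≤ n) (p : ℝ) (hp1 : 1 < p) (hpN : p < N) :
    (∀ f : EuclideanSpace ℝ (Fin n) → ℂ, ContDiff ℝ (⊤ : ℕ∞) f → HasCompactSupport f →
      tsupport f ⊆ {x | ∃ i : Fin N, x (Fin.castLE hNn i) ≠ 0} →
      (∫ x, ‖f x‖ ^ p / sliceNorm N hNn x ^ p) ^ (1 / p)
        ≤ (p / ((N : ℝ) - p)) * (∫ x, ‖fderiv ℝ f x‖ ^ p) ^ (1 / p)) ∧
    (∀ C : ℝ, C < p / ((N : ℝ) - p) →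
      ∃ f : EuclideanSpace ℝ (Fin n) → ℂ,
        ContDiff ℝ (⊤ : ℕ∞) f ∧ HasCompactSupport f ∧
        tsupport f ⊆ {x | ∃ i : Fin N, x (Fin.castLE hNn i) ≠ 0} ∧ f ≠ 0 ∧
        C * (∫ x, ‖fderiv ℝ f x‖ ^ p) ^ (1 / p)
          < (∫ x, ‖f x‖ ^ p / sliceNorm N hNn x ^ p) ^ (1 / p)) := by
  have hset : {x : EuclideanSpace ℝ (Fin n) | ∃ i : Fin N, x (Fin.castLE hNn i) ≠ 0}
      = {x | sliceProj N hNn x ≠ 0} := by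
    ext x
    exact (sliceProj_ne_zero_iff hNn x).symm
  rw [hset]
  exact ⟨fun f hf hc hs => hardy_sliceNorm hNn hp1 hpN hf hc hs,
    fun C hC => exists_lt_hardy_sliceNorm hNn hp1 hpN hC⟩
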